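/- Let w ∈ A_∞ on ℝⁿ. Then for every cube Q, ((1/|Q|) ∫_Q w^{r(w)})^{1/r(w)} ≤ 2 (1/|Q|) ∫_Q w, where r(w) = 1 + 1/(c_n [w]_{A_∞}) and c_n = 2^{11+n}; moreover r(w)′ ≈ [w]_{A_∞}. -/

import Mathlib

open MeasureTheory ENNReal NNReal Set

noncomputable section

/-- Euclidean space `ℝⁿ`. -/
abbrev En (n : ℕ) := EuclideanSpace ℝ (Fin n)

/-- The axis-parallel half-open cube with lower corner `a` and side length `h`. -/
def Cube (n : ℕ) (a : Fin n → ℝ) (h : ℝ) : Set (En n) :=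
  {x | ∀ i, a i ≤ x i ∧ x i < a i + h}

/-- Conjugate exponent `p' = p/(p-1)`. -/
def rconj (p : ℝ) : ℝ := p / (p - 1)

/-- Multilinear fractional maximal operator `M_α`. -/
def MFrac (m n : ℕ) (α : ℝ) (f : Fin m → En n → ℝ) (x : En n) : ℝ≥0∞ :=
  ⨆ (a : Fin n → ℝ) (h : ℝ) (_ : 0 < h) (_ : x ∈ Cube n a h),
    ∏ i, (volume (Cube n a h)) ^ (α / (m * n : ℝ) - 1) *
      ∫⁻ y in Cube n a h, (‖f i y‖₊ : ℝ≥0∞)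

/-- Cube of the translated dyadic grid `D_β`. -/
def GridCube (n : ℕ) (β : Fin n → ℝ) (k : ℤ) (j : Fin n → ℤ) : Set (En n) :=
  Cube n (fun i => (2:ℝ) ^ (-k) * ((j i : ℝ) + (-1 : ℝ) ^ k * β i)) ((2:ℝ) ^ (-k))

/-- Multilinear fractional maximal operator restricted to the grid `D_β`. -/
def MFracGrid (m n : ℕ) (α : ℝ) (β : Fin n → ℝ) (f : Fin m → En n → ℝ) (x : En n) : ℝ≥0∞ :=
  ⨆ (k : ℤ) (j : Fin n → ℤ) (_ : x ∈ GridCube n β k j),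
    ∏ i, (volume (GridCube n β k j)) ^ (α / (m * n : ℝ) - 1) *
      ∫⁻ y in GridCube n β k j, (‖f i y‖₊ : ℝ≥0∞)

/-- The multiple weight constant `[ω]_{A_{(P,q)}}` (all `p i > 1`). -/
def Apq (m n : ℕ) (p : Fin m → ℝ) (q : ℝ) (ω : Fin m → En n → ℝ≥0∞) : ℝ≥0∞ :=
  ⨆ (a : Fin n → ℝ) (h : ℝ) (_ : 0 < h),
    ((volume (Cube n a h))⁻¹ * ∫⁻ x in Cube n a h, (∏ i, ω i x) ^ q) *
      ∏ i, ((volume (Cube n a h))⁻¹ *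
        ∫⁻ x in Cube n a h, ω i x ^ (-(rconj (p i)))) ^ (q / rconj (p i))

/-- Hardy–Littlewood maximal operator (over cubes). -/
def HLMax (n : ℕ) (g : En n → ℝ≥0∞) (x : En n) : ℝ≥0∞ :=
  ⨆ (a : Fin n → ℝ) (h : ℝ) (_ : 0 < h) (_ : x ∈ Cube n a h),
    (volume (Cube n a h))⁻¹ * ∫⁻ y in Cube n a h, g y

/-- The Fujii–Wilson `A_∞` constant. -/
def AInfty (n : ℕ) (w : En n → ℝ≥0∞) : ℝ≥0∞ :=
  ⨆ (a : Fin n → ℝ) (h : ℝ) (_ : 0 < h),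
    (∫⁻ x in Cube n a h, w x)⁻¹ *
      ∫⁻ x in Cube n a h, HLMax n ((Cube n a h).indicator w) x

/-- Weighted `L^p` "norm" `(∫ F^p w)^{1/p}` for `ℝ≥0∞`-valued `F`. -/
def wnorm (n : ℕ) (p : ℝ) (w : En n → ℝ≥0∞) (F : En n → ℝ≥0∞) : ℝ≥0∞ :=
  (∫⁻ x, F x ^ p * w x) ^ (1 / p)

/-- Multilinear fractional maximal operator with rough homogeneous kernel `Ω`. -/
def MOmega (m n : ℕ) (α : ℝ) (Ω : (Fin m → En n) → ℝ) (f : Fin m → En n → ℝ)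
    (x : En n) : ℝ≥0∞ :=
  ⨆ (a : Fin n → ℝ) (h : ℝ) (_ : 0 < h) (_ : x ∈ Cube n a h),
    (volume (Cube n a h)) ^ (α / (n : ℝ) - m) *
      ∫⁻ y in univ.pi (fun _ : Fin m => Cube n a h),
        (‖Ω (fun i => x - y i)‖₊ : ℝ≥0∞) * ∏ i, (‖f i (y i)‖₊ : ℝ≥0∞)

/-- The `L^s((S^{n-1})^m)` norm of a (degree-zero homogeneous) kernel, realized through the
cone measure on the product of unit spheres. -/
def sphereNorm (m n : ℕ) (s : ℝ) (Ω : (Fin m → En n) → ℝ) : ℝ≥0∞ :=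
  eLpNorm Ω (ENNReal.ofReal s)
    (Measure.map (fun (y : Fin m → En n) (i : Fin m) => ‖y i‖⁻¹ • y i)
      (((n : ℝ≥0∞) ^ m) • volume.restrict (univ.pi fun _ : Fin m => Metric.ball (0 : En n) 1)))

/-- Euclidean norm of `(y₁, …, y_m) ∈ (ℝⁿ)^m`. -/
def bigNorm (m n : ℕ) (y : Fin m → En n) : ℝ := Real.sqrt (∑ i, ‖y i‖ ^ 2)

/-- Multilinear fractional integral with rough homogeneous kernel (absolute values). -/
def IOmega (m n : ℕ) (α : ℝ) (Ω : (Fin m → En n) → ℝ) (f : Fin m → En n → ℝ)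
    (x : En n) : ℝ≥0∞ :=
  ∫⁻ y : Fin m → En n,
    ENNReal.ofReal (bigNorm m n y ^ (α - (m * n : ℝ))) * (‖Ω y‖₊ : ℝ≥0∞) *
      ∏ i, (‖f i (x - y i)‖₊ : ℝ≥0∞)

/-- Standard dyadic cube `2^{-k}([0,1)^n + j)`. -/
def DyadicCube (n : ℕ) (k : ℤ) (j : Fin n → ℤ) : Set (En n) :=
  Cube n (fun i => (j i : ℝ) * (2:ℝ) ^ (-k)) ((2:ℝ) ^ (-k))

def IsDyadic (n : ℕ) (S : Set (En n)) : Prop := ∃ k j, S = DyadicCube n k j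

/-- The product of fractional averages `∏_i |S|^{α/(mn)-1} ∫_S |f_i|`. -/
def dyadAvg (m n : ℕ) (α : ℝ) (f : Fin m → En n → ℝ) (S : Set (En n)) : ℝ≥0∞ :=
  ∏ i, (volume S) ^ (α / (m * n : ℝ) - 1) * ∫⁻ y in S, (‖f i y‖₊ : ℝ≥0∞)

/-- Dyadic multilinear fractional maximal operator `M_α^d`. -/
def MFracDyadic (m n : ℕ) (α : ℝ) (f : Fin m → En n → ℝ) (x : En n) : ℝ≥0∞ :=
  ⨆ (k : ℤ) (j : Fin n → ℤ) (_ : x ∈ DyadicCube n k j), dyadAvg m n α f (DyadicCube n k j)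

/-- A maximal (Calderón–Zygmund) dyadic cube of the level set at height `t`. -/
def IsCZCube (m n : ℕ) (α : ℝ) (f : Fin m → En n → ℝ) (t : ℝ≥0∞) (S : Set (En n)) : Prop :=
  IsDyadic n S ∧ t < dyadAvg m n α f S ∧
    ∀ S', IsDyadic n S' → S ⊂ S' → ¬ t < dyadAvg m n α f S'

/-- The multiple weight constant `[ω]_{A_{P}}` of Lerner–Ombrosi–Pérez–Torres–Trujillo. -/
def ApVec (m n : ℕ) (p : Fin m → ℝ) (pp : ℝ) (ω : Fin m → En n → ℝ≥0∞) : ℝ≥0∞ :=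
  ⨆ (a : Fin n → ℝ) (h : ℝ) (_ : 0 < h),
    (∏ i, ((volume (Cube n a h))⁻¹ *
        ∫⁻ x in Cube n a h, ω i x ^ (1 - rconj (p i))) ^ (pp / rconj (p i))) *
      ((volume (Cube n a h))⁻¹ * ∫⁻ x in Cube n a h, ∏ i, ω i x ^ (pp / p i))

/-- `X`-average `‖g‖_{X,Q} = ‖τ_{ℓ(Q)}(g χ_Q)‖_X` of `g` over the cube `Q = Q(a,h)`,
for an abstract Banach-function-space norm functional `N`. -/
def Xavg (n : ℕ) (N : (En n → ℝ≥0∞) → ℝ≥0∞) (a : Fin n → ℝ) (h : ℝ)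
    (g : En n → ℝ≥0∞) : ℝ≥0∞ :=
  N (fun x => (Cube n a h).indicator g (h • x))

/-- Maximal operator `M_X` associated with the norm functional `N`. -/
def MX (n : ℕ) (N : (En n → ℝ≥0∞) → ℝ≥0∞) (g : En n → ℝ≥0∞) (x : En n) : ℝ≥0∞ :=
  ⨆ (a : Fin n → ℝ) (h : ℝ) (_ : 0 < h) (_ : x ∈ Cube n a h), Xavg n N a h g

/-- Weighted fractional maximal operator `M_{σ,α/m}`. -/
def MWFrac (n m : ℕ) (α : ℝ) (σ : En n → ℝ≥0∞) (f : En n → ℝ) (x : En n) : ℝ≥0∞ :=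
  ⨆ (a : Fin n → ℝ) (h : ℝ) (_ : 0 < h) (_ : x ∈ Cube n a h),
    (∫⁻ y in Cube n a h, σ y) ^ (α / (m * n : ℝ) - 1) *
      ∫⁻ y in Cube n a h, (‖f y‖₊ : ℝ≥0∞) * σ y

/-- The reverse Hölder exponent `r(w) = 1 + 1/(c_n [w]_{A_∞})`. -/
def rExp (n : ℕ) (A : ℝ) : ℝ := 1 + 1 / ((2:ℝ) ^ (11 + n) * A)

end

/-- The generation-`i` index of the cell containing `x`, in the dyadic grid generated by the cube
with lower corner `a` and side length `h`. -/
noncomputable def cellIdx (n : ℕ) (a : Fin n → ℝ) (h : ℝ) (i : ℕ) (x : En n) : Fin n → ℤ :=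
  fun l => ⌊(x l - a l) * 2 ^ i / h⌋

/-- The generation-`i` cell containing `x`, in the dyadic grid generated by the cube with lower
corner `a` and side length `h`. -/
noncomputable def cell (n : ℕ) (a : Fin n → ℝ) (h : ℝ) (i : ℕ) (x : En n) : Set (En n) :=
  Cube n (fun l => a l + h / 2 ^ i * cellIdx n a h i x l) (h / 2 ^ i)

section Cells

variable {n : ℕ} {a : Fin n → ℝ} {h : ℝ}

theorem mem_cell_iff (hh : 0 < h) {i : ℕ} {x y : En n} :
    y ∈ cell n a h i x ↔ cellIdx n a h i y = cellIdx n a h i x := by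
  rw [funext_iff]
  refine forall_congr' fun l => ?_
  have h2 : (0 : ℝ) < 2 ^ i := by positivity
  have hz : (y l - a l) * 2 ^ i / h * (h / 2 ^ i) = y l - a l := by field_simp
  have hp : 0 < h / 2 ^ i := by positivity
  change _ ↔ ⌊(y l - a l) * 2 ^ i / h⌋ = _
  rw [Int.floor_eq_iff]
  constructor
  · rintro ⟨h1, h3⟩
    constructor
    · refine le_of_mul_le_mul_right ?_ hp
      linarith
    · refine lt_of_mul_lt_mul_right ?_ hp.le
      linarith
  · rintro ⟨h1, h3⟩
    have h1 := mul_le_mul_of_nonneg_right h1 hp.le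
    have h3 := mul_lt_mul_of_pos_right h3 hp
    constructor <;> linarith

theorem mem_cell_self (hh : 0 < h) (i : ℕ) (x : En n) : x ∈ cell n a h i x :=
  (mem_cell_iff hh).2 rfl

theorem cell_eq_of_mem (hh : 0 < h) {i : ℕ} {x y : En n} (hy : y ∈ cell n a h i x) :
    cell n a h i y = cell n a h i x := by
  rw [mem_cell_iff hh] at hy
  rw [cell, cell, hy]

theorem cell_succ_subset (hh : 0 < h) (i : ℕ) (x : En n) :
    cell n a h (i + 1) x ⊆ cell n a h i x := by
  intro y hy
  rw [mem_cell_iff hh] at hy ⊢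
  have key : ∀ z : ℝ, ⌊z⌋ = ⌊z * 2⌋ / 2 := by
    intro z
    rw [Int.floor_eq_iff]
    have h1 := Int.floor_le (z * 2)
    have h2 := Int.lt_floor_add_one (z * 2)
    have h3 : ((⌊z * 2⌋ / 2 : ℤ) : ℝ) * 2 ≤ ⌊z * 2⌋ := by
      exact_mod_cast (by omega : ⌊z * 2⌋ / 2 * 2 ≤ ⌊z * 2⌋)
    have h4 : (⌊z * 2⌋ : ℝ) + 1 ≤ (⌊z * 2⌋ / 2 : ℤ) * 2 + 2 := by
      exact_mod_cast (by omega : ⌊z * 2⌋ + 1 ≤ ⌊z * 2⌋ / 2 * 2 + 2)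
    constructor <;> linarith
  ext l
  have hl := congrFun hy l
  simp only [cellIdx] at hl ⊢
  rw [key, key ((x l - a l) * 2 ^ i / h)]
  have e : ∀ t : ℝ, t * 2 ^ i / h * 2 = t * 2 ^ (i + 1) / h := fun t => by ring
  rw [e, e, hl]

theorem cell_antitone (hh : 0 < h) (x : En n) : Antitone fun i => cell n a h i x :=
  antitone_nat_of_succ_le fun i => cell_succ_subset hh i x

theorem cell_zero (hh : 0 < h) {x : En n} (hx : x ∈ Cube n a h) : cell n a h 0 x = Cube n a h := by
  have : cellIdx n a h 0 x = 0 := by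
    ext l
    have := hx l
    simp only [cellIdx, pow_zero, mul_one, Pi.zero_apply, Int.floor_eq_zero_iff, mem_Ico]
    rw [div_lt_one hh]
    exact ⟨div_nonneg (by linarith) hh.le, by linarith⟩
  simp [cell, this]

theorem cell_subset_cube (hh : 0 < h) (i : ℕ) {x : En n} (hx : x ∈ Cube n a h) :
    cell n a h i x ⊆ Cube n a h :=
  (cell_antitone hh x (Nat.zero_le i)).trans (cell_zero hh hx).subset

theorem cube_eq_preimage (a : Fin n → ℝ) (h : ℝ) :
    Cube n a h = (WithLp.ofLp : En n → Fin n → ℝ) ⁻¹' univ.pi fun l => Ico (a l) (a l + h) := by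
  ext x
  simp [Cube]

theorem measurableSet_cube (a : Fin n → ℝ) (h : ℝ) : MeasurableSet (Cube n a h) := by
  rw [cube_eq_preimage]
  exact (PiLp.volume_preserving_ofLp (Fin n)).measurable
    (MeasurableSet.univ_pi fun l => measurableSet_Ico)

theorem volume_cube (a : Fin n → ℝ) (h : ℝ) :
    volume (Cube n a h) = ENNReal.ofReal h ^ n := by
  rw [cube_eq_preimage, (PiLp.volume_preserving_ofLp (Fin n)).measure_preimage
    (MeasurableSet.univ_pi fun l => measurableSet_Ico).nullMeasurableSet, Real.volume_pi_Ico]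
  simp

theorem volume_cube_ne_zero (hh : 0 < h) : volume (Cube n a h) ≠ 0 := by
  rw [volume_cube]
  exact pow_ne_zero _ (by simpa using hh)

theorem volume_cube_ne_top : volume (Cube n a h) ≠ ⊤ := by
  rw [volume_cube]
  finiteness

theorem measurableSet_cell (i : ℕ) (x : En n) : MeasurableSet (cell n a h i x) :=
  measurableSet_cube _ _

theorem volume_cell_succ (i : ℕ) (x : En n) :
    volume (cell n a h i x) = 2 ^ n * volume (cell n a h (i + 1) x) := by
  rw [cell, cell, volume_cube, volume_cube, ← mul_pow]
  congr 1
  rw [← ENNReal.ofReal_ofNat 2, ← ENNReal.ofReal_mul (by norm_num)]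
  congr 1
  field_simp
  ring

theorem measurable_cellIdx (i : ℕ) : Measurable (cellIdx n a h i) := by
  unfold cellIdx
  fun_prop

theorem setLIntegral_cube_le_of_cell (hh : 0 < h) (i : ℕ) {F G : En n → ℝ≥0∞}
    (H : ∀ x ∈ Cube n a h, ∫⁻ y in cell n a h i x, F y ≤ ∫⁻ y in cell n a h i x, G y) :
    ∫⁻ y in Cube n a h, F y ≤ ∫⁻ y in Cube n a h, G y := by
  have hQ : Cube n a h = ⋃ j, cellIdx n a h i ⁻¹' {j} ∩ Cube n a h := by
    ext x
    simp
  have hm : ∀ j, MeasurableSet (cellIdx n a h i ⁻¹' {j} ∩ Cube n a h) := fun j =>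
    (measurable_cellIdx i (measurableSet_singleton j)).inter (measurableSet_cube a h)
  have hd : Pairwise (Function.onFun Disjoint fun j => cellIdx n a h i ⁻¹' {j} ∩ Cube n a h) := by
    intro j k hjk
    refine Set.disjoint_left.2 fun x hx hx' => hjk ?_
    exact hx.1.symm.trans hx'.1
  rw [hQ, lintegral_iUnion hm hd, lintegral_iUnion hm hd]
  refine ENNReal.tsum_le_tsum fun j => ?_
  obtain hj | ⟨x, rfl, hx⟩ := (cellIdx n a h i ⁻¹' {j} ∩ Cube n a h).eq_empty_or_nonempty
  · simp [hj]
  · have : cellIdx n a h i ⁻¹' {cellIdx n a h i x} ∩ Cube n a h = cell n a h i x := by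
      ext y
      simp only [mem_inter_iff, mem_preimage, mem_singleton_iff, ← mem_cell_iff hh]
      exact ⟨And.left, fun hy => ⟨hy, cell_subset_cube hh i hx hy⟩⟩
    rw [this]
    exact H x hx

end Cells

/-- The average of `w` over the generation-`i` cell containing `x`. -/
noncomputable def cellAvg (n : ℕ) (a : Fin n → ℝ) (h : ℝ) (w : En n → ℝ≥0∞) (i : ℕ) (x : En n) :
    ℝ≥0∞ :=
  (volume (cell n a h i x))⁻¹ * ∫⁻ y in cell n a h i x, w y

/-- The dyadic maximal function of `w`, restricted to cells of generation at most `k`. -/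
noncomputable def cellMax (n : ℕ) (a : Fin n → ℝ) (h : ℝ) (w : En n → ℝ≥0∞) (k : ℕ) (x : En n) :
    ℝ≥0∞ :=
  partialSups (fun i => cellAvg n a h w i x) k

section Averages

variable {n : ℕ} {a : Fin n → ℝ} {h : ℝ} {w : En n → ℝ≥0∞}

theorem volume_cell_ne_zero (hh : 0 < h) (i : ℕ) (x : En n) : volume (cell n a h i x) ≠ 0 :=
  volume_cube_ne_zero (by positivity)

theorem volume_cell_ne_top (i : ℕ) (x : En n) : volume (cell n a h i x) ≠ ⊤ :=
  volume_cube_ne_top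

theorem measurable_cellAvg (i : ℕ) : Measurable (cellAvg n a h w i) :=
  (measurable_of_countable fun j : Fin n → ℤ =>
    (volume (Cube n (fun l => a l + h / 2 ^ i * j l) (h / 2 ^ i)))⁻¹ *
      ∫⁻ y in Cube n (fun l => a l + h / 2 ^ i * j l) (h / 2 ^ i), w y).comp
    (measurable_cellIdx i)

theorem cellMax_zero (x : En n) : cellMax n a h w 0 x = cellAvg n a h w 0 x := by
  simp [cellMax]

theorem cellMax_succ (k : ℕ) (x : En n) :
    cellMax n a h w (k + 1) x = max (cellMax n a h w k x) (cellAvg n a h w (k + 1) x) := by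
  simp [cellMax]

theorem measurable_cellMax (k : ℕ) : Measurable (cellMax n a h w k) := by
  induction k with
  | zero => simpa only [← funext cellMax_zero] using measurable_cellAvg 0
  | succ k ih =>
    rw [funext (cellMax_succ k)]
    exact ih.max (measurable_cellAvg _)

theorem cellMax_mono (x : En n) : Monotone fun k => cellMax n a h w k x :=
  (partialSups _).monotone

theorem cellAvg_eq_of_mem (hh : 0 < h) {i : ℕ} {x y : En n} (hy : y ∈ cell n a h i x) :
    cellAvg n a h w i y = cellAvg n a h w i x := by
  rw [cellAvg, cellAvg, cell_eq_of_mem hh hy]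

theorem cellMax_eq_of_mem (hh : 0 < h) {k : ℕ} {x y : En n} (hy : y ∈ cell n a h k x) :
    cellMax n a h w k y = cellMax n a h w k x := by
  induction k with
  | zero => simp [cellMax_zero, cellAvg_eq_of_mem hh hy]
  | succ k ih =>
    rw [cellMax_succ, cellMax_succ, cellAvg_eq_of_mem hh hy, ih (cell_succ_subset hh k x hy)]

theorem cellAvg_mul_volume (hh : 0 < h) (i : ℕ) (x : En n) :
    cellAvg n a h w i x * volume (cell n a h i x) = ∫⁻ y in cell n a h i x, w y := by
  rw [cellAvg, mul_right_comm,
    ENNReal.inv_mul_cancel (volume_cell_ne_zero hh i x) (volume_cell_ne_top i x), one_mul]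

theorem cellAvg_succ_le (hh : 0 < h) (i : ℕ) (x : En n) :
    cellAvg n a h w (i + 1) x ≤ 2 ^ n * cellAvg n a h w i x := by
  rw [cellAvg, cellAvg, volume_cell_succ i, ← mul_assoc,
    ENNReal.mul_inv (Or.inl (by simp)) (Or.inl (by simp)), ← mul_assoc,
    ENNReal.mul_inv_cancel (by simp) (by simp), one_mul]
  gcongr
  exact cell_succ_subset hh i x

theorem cellAvg_le_cellMax {i k : ℕ} (hik : i ≤ k) (x : En n) :
    cellAvg n a h w i x ≤ cellMax n a h w k x :=
  le_partialSups_of_le (fun i => cellAvg n a h w i x) hik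

theorem cellMax_succ_le (hh : 0 < h) (k : ℕ) (x : En n) :
    cellMax n a h w (k + 1) x ≤ 2 ^ n * cellMax n a h w k x := by
  rw [cellMax_succ]
  refine max_le (le_mul_of_one_le_left' (one_le_pow₀ (by norm_num))) ?_
  exact (cellAvg_succ_le hh k x).trans (by gcongr; exact cellAvg_le_cellMax le_rfl x)

theorem cellMax_le (hh : 0 < h) (k : ℕ) (x : En n) :
    cellMax n a h w k x ≤ (2 ^ n) ^ k * cellAvg n a h w 0 x := by
  induction k with
  | zero => simp [cellMax_zero]
  | succ k ih =>
    refine (cellMax_succ_le hh k x).trans ?_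
    rw [pow_succ', mul_assoc]
    gcongr

theorem cellMax_le_HLMax (hh : 0 < h) {j k : ℕ} {x y : En n}
    (hx : cellMax n a h w j x = cellAvg n a h w j x) (hy : y ∈ cell n a h j x) :
    cellMax n a h w k y ≤ HLMax n ((cell n a h j x).indicator w) y := by
  have hbound : ∀ i, j ≤ i →
      cellAvg n a h w i y ≤ HLMax n ((cell n a h j x).indicator w) y := by
    intro i hi
    have hsub : cell n a h i y ⊆ cell n a h j x := by
      rw [← cell_eq_of_mem hh hy]
      exact cell_antitone hh y hi
    have hint : ∫⁻ z in cell n a h i y, (cell n a h j x).indicator w z =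
        ∫⁻ z in cell n a h i y, w z :=
      setLIntegral_congr_fun (measurableSet_cell i y) fun z hz => indicator_of_mem (hsub hz) w
    rw [cellAvg, ← hint, HLMax]
    exact le_iSup₂_of_le _ _ <| le_iSup₂_of_le (by positivity) (mem_cell_self hh i y) le_rfl
  refine partialSups_le _ _ _ fun i _ => ?_
  rcases le_total j i with hi | hi
  · exact hbound i hi
  · calc cellAvg n a h w i y ≤ cellMax n a h w j y := cellAvg_le_cellMax hi y
      _ = cellAvg n a h w j y := by
        rw [cellMax_eq_of_mem hh hy, hx, cellAvg_eq_of_mem hh hy]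
      _ ≤ _ := hbound j le_rfl

theorem setLIntegral_HLMax_le {a : Fin n → ℝ} {h : ℝ} (hh : 0 < h)
    (h0 : ∫⁻ x in Cube n a h, w x ≠ 0) (ht : ∫⁻ x in Cube n a h, w x ≠ ⊤) :
    ∫⁻ x in Cube n a h, HLMax n ((Cube n a h).indicator w) x ≤
      AInfty n w * ∫⁻ x in Cube n a h, w x := by
  have : (∫⁻ x in Cube n a h, w x)⁻¹ *
      ∫⁻ x in Cube n a h, HLMax n ((Cube n a h).indicator w) x ≤ AInfty n w :=
    le_iSup₂_of_le a h <| le_iSup_of_le hh le_rfl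
  rwa [mul_comm, ← div_eq_mul_inv, ENNReal.div_le_iff h0 ht] at this

theorem tendsto_cellAvg (hh : 0 < h) (hw : Measurable w)
    (ht : ∫⁻ x in Cube n a h, w x ≠ ⊤) :
    ∀ᵐ x, x ∈ Cube n a h →
      Filter.Tendsto (fun i => cellAvg n a h w i x) Filter.atTop (nhds (w x)) := by
  have hmp := PiLp.volume_preserving_ofLp (Fin n)
  have hm : Measurable ((Cube n a h).indicator w) := hw.indicator (measurableSet_cube a h)
  have hmt : Measurable (WithLp.toLp 2 : (Fin n → ℝ) → En n) :=
    (PiLp.volume_preserving_toLp (Fin n)).measurable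
  set f : (Fin n → ℝ) → ℝ≥0∞ := fun z => (Cube n a h).indicator w (WithLp.toLp 2 z) with hf
  have hfm : Measurable f := hm.comp hmt
  have hfi : ∫⁻ z, f z ≠ ⊤ := by
    rwa [← hmp.lintegral_comp hfm, lintegral_indicator (measurableSet_cube a h)]
  have hcomp : ∀ S : Set (Fin n → ℝ), MeasurableSet S →
      ∫⁻ x in (WithLp.ofLp : En n → Fin n → ℝ) ⁻¹' S, (Cube n a h).indicator w x =
        ∫⁻ z in S, f z := fun S hS => hmp.setLIntegral_comp_preimage hS hfm
  have hae := (IsUnifLocDoublingMeasure.vitaliFamily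
    (volume : Measure (Fin n → ℝ)) 1).ae_tendsto_lintegral_div hfm.aemeasurable hfi
  filter_upwards [hmp.quasiMeasurePreserving.ae hae] with x hx hxQ
  have hfx : f (WithLp.ofLp x) = w x := indicator_of_mem hxQ w
  rw [hfx] at hx
  have hball : ∀ i : ℕ, Metric.closedBall
      (fun l => a l + h / 2 ^ i * cellIdx n a h i x l + h / 2 ^ i / 2) (h / 2 ^ i / 2) =
      univ.pi fun l => Icc (a l + h / 2 ^ i * cellIdx n a h i x l)
        (a l + h / 2 ^ i * cellIdx n a h i x l + h / 2 ^ i) := by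
    intro i
    rw [closedBall_pi _ (by positivity)]
    congr 1
    ext1 l
    rw [Real.closedBall_eq_Icc]
    congr 1 <;> ring
  have hδ : Filter.Tendsto (fun i : ℕ => h / 2 ^ i / 2) Filter.atTop (nhdsWithin 0 (Ioi 0)) := by
    refine tendsto_nhdsWithin_iff.2 ⟨?_, Filter.Eventually.of_forall fun i => ?_⟩
    · have := (tendsto_pow_atTop_nhds_zero_of_lt_one (r := (1 / 2 : ℝ))
        (by norm_num) (by norm_num)).const_mul (h / 2)
      rw [mul_zero] at this
      refine this.congr fun i => ?_
      rw [one_div, inv_pow]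
      ring
    · exact mem_Ioi.2 (by positivity)
  have hlim := hx.comp (IsUnifLocDoublingMeasure.tendsto_closedBall_filterAt
    (volume : Measure (Fin n → ℝ)) (K := 1) (x := WithLp.ofLp x)
    (fun i : ℕ => fun l => a l + h / 2 ^ i * cellIdx n a h i x l + h / 2 ^ i / 2)
    (fun i : ℕ => h / 2 ^ i / 2) hδ (Filter.Eventually.of_forall fun i => by
      rw [one_mul, hball i]
      intro l _
      have := mem_cell_self (a := a) hh i x l
      exact ⟨this.1, this.2.le⟩))
  refine hlim.congr fun i => ?_
  have hS : MeasurableSet (univ.pi fun l => Ico (a l + h / 2 ^ i * cellIdx n a h i x l)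
        (a l + h / 2 ^ i * cellIdx n a h i x l + h / 2 ^ i)) :=
    MeasurableSet.univ_pi fun l => measurableSet_Ico
  have hae : (univ.pi fun l => Ico (a l + h / 2 ^ i * cellIdx n a h i x l)
        (a l + h / 2 ^ i * cellIdx n a h i x l + h / 2 ^ i)) =ᵐ[volume]
      univ.pi fun l => Icc (a l + h / 2 ^ i * cellIdx n a h i x l)
        (a l + h / 2 ^ i * cellIdx n a h i x l + h / 2 ^ i) := by
    have := Measure.univ_pi_Ico_ae_eq_Icc (μ := fun _ : Fin n => (volume : Measure ℝ))
      (f := fun l => a l + h / 2 ^ i * cellIdx n a h i x l)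
      (g := fun l => a l + h / 2 ^ i * cellIdx n a h i x l + h / 2 ^ i)
    rwa [← pi_univ_Icc] at this
  rw [Function.comp_apply, hball i, ← measure_congr hae, ← setLIntegral_congr hae, ← hcomp _ hS,
    ← hmp.measure_preimage hS.nullMeasurableSet, ← cube_eq_preimage, div_eq_mul_inv, mul_comm]
  refine congrArg _ (setLIntegral_congr_fun (measurableSet_cell i x) fun y hy => ?_)
  exact indicator_of_mem (cell_subset_cube hh i hxQ hy) w

end Averages

theorem NNReal.rpow_mul_add_le {a b : ℝ≥0} {ε : ℝ≥0} (hε : 0 < ε) (hba : b ≤ a) :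
    a ^ (ε : ℝ) * b + ε * b ^ (1 + ε : ℝ) ≤ b ^ (1 + ε : ℝ) + ε * a ^ (1 + ε : ℝ) := by
  have h1 : (0 : ℝ) < 1 + ε := by positivity
  have hle : b ^ (1 + ε : ℝ) ≤ a ^ (1 + ε : ℝ) := NNReal.rpow_le_rpow hba h1.le
  have hamgm := Real.geom_mean_le_arith_mean2_weighted (w₁ := ε / (1 + ε)) (w₂ := 1 / (1 + ε))
    (p₁ := (a ^ (1 + ε : ℝ) : ℝ≥0)) (p₂ := (b ^ (1 + ε : ℝ) : ℝ≥0))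
    (by positivity) (by positivity) (by positivity) (by positivity) (by field_simp; ring)
  rw [NNReal.coe_rpow, NNReal.coe_rpow, ← Real.rpow_mul a.coe_nonneg, ← Real.rpow_mul b.coe_nonneg,
    mul_div_cancel₀ _ h1.ne', mul_one_div_cancel h1.ne', Real.rpow_one] at hamgm
  rw [← NNReal.coe_le_coe] at hle ⊢
  push_cast at hle ⊢
  have hε' : (0 : ℝ) < ε := hε
  generalize (a : ℝ) ^ (1 + ε : ℝ) = s at *
  generalize (b : ℝ) ^ (1 + ε : ℝ) = t at *
  have h2 : (ε : ℝ) / (1 + ε) * s + 1 / (1 + ε) * t ≤ t + ε * s - ε * t := by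
    have : (ε : ℝ) / (1 + ε) * s + 1 / (1 + ε) * t = (ε * s + t) / (1 + ε) := by ring
    rw [this, div_le_iff₀ h1]
    nlinarith [mul_nonneg (sq_nonneg (ε : ℝ)) (sub_nonneg.2 hle)]
  linarith

/-- A discrete integration by parts inequality for one step of a maximal function. -/
theorem ENNReal.rpow_mul_add_le_of_le {a b g v A D : ℝ≥0∞} {ε : ℝ≥0} (hε : 0 < ε) (ha : a ≠ ⊤)
    (hba : b ≤ a) (haD : a ≤ D * b) (hg : g ≤ A * (a * v)) :
    a ^ (ε : ℝ) * g + A * D * ε * (b ^ (1 + ε : ℝ) * v) ≤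
      b ^ (ε : ℝ) * g + A * D * ε * (a ^ (1 + ε : ℝ) * v) := by
  have hb : b ≠ ⊤ := ne_top_of_le_ne_top ha hba
  have h1 : (0 : ℝ) ≤ 1 + ε := by positivity
  obtain ⟨d, hd⟩ : ∃ d, a ^ (ε : ℝ) = b ^ (ε : ℝ) + d :=
    exists_add_of_le (ENNReal.rpow_le_rpow hba ε.coe_nonneg)
  have key : d * b + ε * b ^ (1 + ε : ℝ) ≤ ε * a ^ (1 + ε : ℝ) := by
    have hbb : b ^ (1 + ε : ℝ) = b ^ (ε : ℝ) * b := by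
      rw [add_comm, ENNReal.rpow_add_of_nonneg _ _ ε.coe_nonneg zero_le_one, ENNReal.rpow_one]
    have hN : a ^ (ε : ℝ) * b + ε * b ^ (1 + ε : ℝ) ≤ b ^ (1 + ε : ℝ) + ε * a ^ (1 + ε : ℝ) := by
      lift a to ℝ≥0 using ha
      lift b to ℝ≥0 using hb
      rw [← ENNReal.coe_rpow_of_nonneg _ ε.coe_nonneg, ← ENNReal.coe_rpow_of_nonneg _ h1,
        ← ENNReal.coe_rpow_of_nonneg _ h1]
      exact_mod_cast NNReal.rpow_mul_add_le hε (by exact_mod_cast hba)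
    rw [hd, add_mul, ← hbb, add_assoc] at hN
    exact (ENNReal.add_le_add_iff_left (ENNReal.rpow_ne_top_of_nonneg h1 hb)).1 hN
  calc a ^ (ε : ℝ) * g + A * D * ε * (b ^ (1 + ε : ℝ) * v)
      = b ^ (ε : ℝ) * g + (d * g + A * D * ε * (b ^ (1 + ε : ℝ) * v)) := by rw [hd]; ring
    _ ≤ b ^ (ε : ℝ) * g + (d * (A * (D * b * v)) + A * D * ε * (b ^ (1 + ε : ℝ) * v)) := by
        gcongr
        exact hg.trans (by gcongr)
    _ = b ^ (ε : ℝ) * g + A * D * v * (d * b + ε * b ^ (1 + ε : ℝ)) := by ring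
    _ ≤ b ^ (ε : ℝ) * g + A * D * v * (ε * a ^ (1 + ε : ℝ)) := by gcongr
    _ = _ := by ring

section ReverseHolder

variable {n : ℕ} {a : Fin n → ℝ} {h : ℝ} {w : En n → ℝ≥0∞}

theorem cellAvg_zero (hh : 0 < h) {x : En n} (hx : x ∈ Cube n a h) :
    cellAvg n a h w 0 x = (volume (Cube n a h))⁻¹ * ∫⁻ y in Cube n a h, w y := by
  rw [cellAvg, cell_zero hh hx]

theorem cellAvg_zero_ne_top (hh : 0 < h) (ht : ∫⁻ x in Cube n a h, w x ≠ ⊤) {x : En n}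
    (hx : x ∈ Cube n a h) : cellAvg n a h w 0 x ≠ ⊤ := by
  rw [cellAvg_zero hh hx]
  exact ENNReal.mul_ne_top (ENNReal.inv_ne_top.2 (volume_cube_ne_zero hh)) ht

theorem cellMax_ne_top (hh : 0 < h) (ht : ∫⁻ x in Cube n a h, w x ≠ ⊤) (k : ℕ) {x : En n}
    (hx : x ∈ Cube n a h) : cellMax n a h w k x ≠ ⊤ :=
  ne_top_of_le_ne_top (ENNReal.mul_ne_top (by simp) (cellAvg_zero_ne_top hh ht hx))
    (cellMax_le hh k x)

theorem setLIntegral_cellMax_rpow_ne_top (hh : 0 < h) (ht : ∫⁻ x in Cube n a h, w x ≠ ⊤)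
    (k : ℕ) {r : ℝ} (hr : 0 ≤ r) : ∫⁻ x in Cube n a h, cellMax n a h w k x ^ r ≠ ⊤ := by
  refine ne_top_of_le_ne_top (b := ((2 ^ n) ^ k *
    ((volume (Cube n a h))⁻¹ * ∫⁻ y in Cube n a h, w y)) ^ r * volume (Cube n a h)) ?_ ?_
  · refine ENNReal.mul_ne_top (ENNReal.rpow_ne_top_of_nonneg hr ?_) volume_cube_ne_top
    exact ENNReal.mul_ne_top (by simp)
      (ENNReal.mul_ne_top (ENNReal.inv_ne_top.2 (volume_cube_ne_zero hh)) ht)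
  · rw [← setLIntegral_const]
    refine setLIntegral_mono' (measurableSet_cube a h) fun x hx => ?_
    rw [← cellAvg_zero hh hx]
    exact ENNReal.rpow_le_rpow (cellMax_le hh k x) hr

theorem setLIntegral_cellMax_succ_add_le (hh : 0 < h) (ht : ∫⁻ x in Cube n a h, w x ≠ ⊤)
    {g : En n → ℝ≥0∞} (hg : Measurable g) {A : ℝ≥0∞} {ε : ℝ≥0} (hε : 0 < ε) {k : ℕ}
    (H : ∀ x ∈ Cube n a h, cellMax n a h w (k + 1) x = cellAvg n a h w (k + 1) x →
      ∫⁻ y in cell n a h (k + 1) x, g y ≤ A * ∫⁻ y in cell n a h (k + 1) x, w y) :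
    (∫⁻ x in Cube n a h, cellMax n a h w (k + 1) x ^ (ε : ℝ) * g x) +
        A * 2 ^ n * ε * ∫⁻ x in Cube n a h, cellMax n a h w k x ^ (1 + ε : ℝ) ≤
      (∫⁻ x in Cube n a h, cellMax n a h w k x ^ (ε : ℝ) * g x) +
        A * 2 ^ n * ε * ∫⁻ x in Cube n a h, cellMax n a h w (k + 1) x ^ (1 + ε : ℝ) := by
  have hm := fun k => measurable_cellMax (n := n) (a := a) (h := h) (w := w) k
  have hmg : ∀ k, Measurable fun x => cellMax n a h w k x ^ (ε : ℝ) * g x := fun k =>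
    ((hm k).pow_const _).mul hg
  rw [← lintegral_const_mul _ ((hm k).pow_const _),
    ← lintegral_const_mul _ ((hm (k + 1)).pow_const _),
    ← lintegral_add_left (hmg (k + 1)), ← lintegral_add_left (hmg k)]
  refine setLIntegral_cube_le_of_cell hh (k + 1) fun x hx => ?_
  have hconst : ∀ i j, i ≤ k + 1 → j ≤ k + 1 →
      ∫⁻ y in cell n a h (k + 1) x, (cellMax n a h w i y ^ (ε : ℝ) * g y +
        A * 2 ^ n * ε * cellMax n a h w j y ^ (1 + ε : ℝ)) =
      cellMax n a h w i x ^ (ε : ℝ) * (∫⁻ y in cell n a h (k + 1) x, g y) +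
        A * 2 ^ n * ε * (cellMax n a h w j x ^ (1 + ε : ℝ) * volume (cell n a h (k + 1) x)) := by
    intro i j hi hj
    rw [setLIntegral_congr_fun (g := fun y => cellMax n a h w i x ^ (ε : ℝ) * g y +
        A * 2 ^ n * ε * cellMax n a h w j x ^ (1 + ε : ℝ)) (measurableSet_cell _ _),
      lintegral_add_left (hg.const_mul _), lintegral_const_mul _ hg, setLIntegral_const, mul_assoc]
    intro y hy
    dsimp only
    rw [cellMax_eq_of_mem hh (cell_antitone hh x hi hy),
      cellMax_eq_of_mem hh (cell_antitone hh x hj hy)]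
  rw [hconst _ _ le_rfl k.le_succ, hconst _ _ k.le_succ le_rfl]
  rcases le_total (cellAvg n a h w (k + 1) x) (cellMax n a h w k x) with hle | hle
  · rw [cellMax_succ, max_eq_left hle]
  · have hmax : cellMax n a h w (k + 1) x = cellAvg n a h w (k + 1) x := by
      rw [cellMax_succ, max_eq_right hle]
    refine ENNReal.rpow_mul_add_le_of_le hε (cellMax_ne_top hh ht _ hx)
      (cellMax_mono x k.le_succ) (cellMax_succ_le hh k x) ?_
    rw [hmax, cellAvg_mul_volume hh]
    exact H x hx hmax

theorem setLIntegral_cellMax_rpow_mul_le (hh : 0 < h) (ht : ∫⁻ x in Cube n a h, w x ≠ ⊤)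
    {g : En n → ℝ≥0∞} (hg : Measurable g) {A : ℝ≥0∞} (hA : A ≠ ⊤) {ε : ℝ≥0} (hε : 0 < ε)
    (H : ∀ x ∈ Cube n a h, ∀ k, cellMax n a h w k x = cellAvg n a h w k x →
      ∫⁻ y in cell n a h k x, g y ≤ A * ∫⁻ y in cell n a h k x, w y) (k : ℕ) :
    ∫⁻ x in Cube n a h, cellMax n a h w k x ^ (ε : ℝ) * g x ≤
      ((volume (Cube n a h))⁻¹ * ∫⁻ x in Cube n a h, w x) ^ (ε : ℝ) * (∫⁻ x in Cube n a h, g x) +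
        A * 2 ^ n * ε * ∫⁻ x in Cube n a h, cellMax n a h w k x ^ (1 + ε : ℝ) := by
  induction k with
  | zero =>
    refine le_trans (le_of_eq ?_) le_self_add
    rw [← lintegral_const_mul _ hg]
    refine setLIntegral_congr_fun (measurableSet_cube a h) fun x hx => ?_
    rw [cellMax_zero, cellAvg_zero hh hx]
  | succ k ih =>
    have hfin : A * 2 ^ n * ε * ∫⁻ x in Cube n a h, cellMax n a h w k x ^ (1 + ε : ℝ) ≠ ⊤ :=
      ENNReal.mul_ne_top (by finiteness)
        (setLIntegral_cellMax_rpow_ne_top hh ht k (by positivity))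
    have hstep := (setLIntegral_cellMax_succ_add_le hh ht hg hε fun x hx => H x hx (k + 1)).trans
      (add_le_add_left ih _)
    rw [add_right_comm] at hstep
    exact (ENNReal.add_le_add_iff_right hfin).1 hstep

theorem setLIntegral_cellMax_le (hh : 0 < h) (h0 : ∫⁻ x in Cube n a h, w x ≠ 0)
    (ht : ∫⁻ x in Cube n a h, w x ≠ ⊤) {j : ℕ} (k : ℕ) {x : En n} (hx : x ∈ Cube n a h)
    (hj : cellMax n a h w j x = cellAvg n a h w j x) :
    ∫⁻ y in cell n a h j x, cellMax n a h w k y ≤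
      AInfty n w * ∫⁻ y in cell n a h j x, w y := by
  refine (setLIntegral_mono' (measurableSet_cell j x) fun y hy =>
    cellMax_le_HLMax hh hj hy).trans (setLIntegral_HLMax_le (by positivity) ?_ ?_)
  · change ∫⁻ y in cell n a h j x, w y ≠ 0
    rw [← cellAvg_mul_volume hh, ← hj]
    refine mul_ne_zero (ne_of_gt (lt_of_lt_of_le ?_ (cellAvg_le_cellMax j.zero_le x)))
      (volume_cell_ne_zero hh j x)
    rw [cellAvg_zero hh hx]
    exact pos_iff_ne_zero.2 (mul_ne_zero (ENNReal.inv_ne_zero.2 volume_cube_ne_top) h0)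
  · exact ne_top_of_le_ne_top ht (lintegral_mono_set (cell_subset_cube hh j hx))

theorem setLIntegral_cellMax_rpow_le (hh : 0 < h) (h0 : ∫⁻ x in Cube n a h, w x ≠ 0)
    (ht : ∫⁻ x in Cube n a h, w x ≠ ⊤) (hfin : AInfty n w ≠ ⊤) {ε : ℝ≥0} (hε : 0 < ε)
    (hεA : 2 * (AInfty n w * 2 ^ n * ε) ≤ 1) (k : ℕ) :
    ∫⁻ x in Cube n a h, cellMax n a h w k x ^ (1 + ε : ℝ) ≤
      2 * (((volume (Cube n a h))⁻¹ * ∫⁻ x in Cube n a h, w x) ^ (ε : ℝ) *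
        (AInfty n w * ∫⁻ x in Cube n a h, w x)) := by
  have hX := setLIntegral_cellMax_rpow_ne_top hh ht k (r := 1 + ε) (by positivity)
  have hmain := setLIntegral_cellMax_rpow_mul_le hh ht (measurable_cellMax k) hfin hε
    (fun x hx j hj => setLIntegral_cellMax_le hh h0 ht k hx hj) k
  have hpow : ∀ t : ℝ≥0∞, t ^ (ε : ℝ) * t = t ^ (1 + ε : ℝ) := fun t => by
    rw [add_comm (1 : ℝ), ENNReal.rpow_add_of_nonneg _ _ ε.coe_nonneg zero_le_one,
      ENNReal.rpow_one]
  simp only [hpow] at hmain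
  have hg : ∫⁻ x in Cube n a h, cellMax n a h w k x ≤
      AInfty n w * ∫⁻ x in Cube n a h, w x := by
    obtain ⟨x, hx⟩ : (Cube n a h).Nonempty :=
      nonempty_of_measure_ne_zero (volume_cube_ne_zero hh)
    have := setLIntegral_cellMax_le hh h0 ht k hx (cellMax_zero x)
    rwa [cell_zero hh hx] at this
  generalize ∫⁻ x in Cube n a h, cellMax n a h w k x ^ (1 + ε : ℝ) = X at hX hmain ⊢
  set Y := ((volume (Cube n a h))⁻¹ * ∫⁻ x in Cube n a h, w x) ^ (ε : ℝ) *
    (AInfty n w * ∫⁻ x in Cube n a h, w x) with hY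
  have : X + X ≤ 2 * Y + X := calc
    X + X = 2 * X := by ring
    _ ≤ 2 * (Y + AInfty n w * 2 ^ n * ε * X) := by
      gcongr
      exact hmain.trans (by rw [hY]; gcongr)
    _ = 2 * Y + 2 * (AInfty n w * 2 ^ n * ε) * X := by ring
    _ ≤ 2 * Y + 1 * X := by gcongr
    _ = _ := by rw [one_mul]
  exact (ENNReal.add_le_add_iff_right hX).1 this

theorem setLIntegral_rpow_le (hh : 0 < h) (hw : Measurable w)
    (h0 : ∫⁻ x in Cube n a h, w x ≠ 0) (ht : ∫⁻ x in Cube n a h, w x ≠ ⊤)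
    (hfin : AInfty n w ≠ ⊤) {ε : ℝ≥0} (hε : 0 < ε)
    (hεA : 2 * (AInfty n w * 2 ^ n * ε) ≤ 1) :
    ∫⁻ x in Cube n a h, w x ^ (1 + ε : ℝ) ≤
      2 * (((volume (Cube n a h))⁻¹ * ∫⁻ x in Cube n a h, w x) ^ (ε : ℝ) *
        ∫⁻ x in Cube n a h, w x) := by
  have hk : ∀ k, ∫⁻ x in Cube n a h, cellMax n a h w k x ^ (ε : ℝ) * w x ≤
      2 * (((volume (Cube n a h))⁻¹ * ∫⁻ x in Cube n a h, w x) ^ (ε : ℝ) *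
        ∫⁻ x in Cube n a h, w x) := by
    intro k
    refine (setLIntegral_cellMax_rpow_mul_le hh ht hw one_ne_top hε
      (fun x hx j hj => by rw [one_mul]) k).trans ?_
    have hX := setLIntegral_cellMax_rpow_le hh h0 ht hfin hε hεA k
    generalize ∫⁻ x in Cube n a h, cellMax n a h w k x ^ (1 + ε : ℝ) = X at hX ⊢
    generalize ((volume (Cube n a h))⁻¹ * ∫⁻ x in Cube n a h, w x) ^ (ε : ℝ) = c at hX ⊢
    generalize ∫⁻ x in Cube n a h, w x = W at hX ⊢
    calc c * W + 1 * 2 ^ n * ε * X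
        ≤ c * W + 1 * 2 ^ n * ε * (2 * (c * (AInfty n w * W))) := by gcongr
      _ = c * W + 2 * (AInfty n w * 2 ^ n * ε) * (c * W) := by ring
      _ ≤ c * W + 1 * (c * W) := by gcongr
      _ = 2 * (c * W) := by ring
  calc ∫⁻ x in Cube n a h, w x ^ (1 + ε : ℝ)
      ≤ ∫⁻ x in Cube n a h, ⨆ k, cellMax n a h w k x ^ (ε : ℝ) * w x := by
        refine setLIntegral_mono_ae' (measurableSet_cube a h) ?_
        filter_upwards [tendsto_cellAvg hh hw ht] with x hx hxQ
        rw [add_comm (1 : ℝ), ENNReal.rpow_add_of_nonneg _ _ ε.coe_nonneg zero_le_one,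
          ENNReal.rpow_one, ← ENNReal.iSup_mul]
        gcongr
        have hlim := (ENNReal.continuous_rpow_const (y := (ε : ℝ))).continuousAt.tendsto.comp
          (hx hxQ)
        refine le_of_tendsto' hlim fun i => ?_
        exact (ENNReal.rpow_le_rpow (cellAvg_le_cellMax le_rfl x) ε.coe_nonneg).trans
          (le_iSup (fun k => cellMax n a h w k x ^ (ε : ℝ)) i)
    _ = ⨆ k, ∫⁻ x in Cube n a h, cellMax n a h w k x ^ (ε : ℝ) * w x := by
        refine lintegral_iSup (fun k => ((measurable_cellMax k).pow_const _).mul hw) ?_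
        intro i j hij x
        dsimp only
        gcongr
        exact cellMax_mono x hij
    _ ≤ _ := iSup_le hk

theorem setLAverage_rpow_le (hh : 0 < h) (hw : Measurable w) (hfin : AInfty n w ≠ ⊤)
    {ε : ℝ≥0} (hε : 0 < ε) (hεA : 2 * (AInfty n w * 2 ^ n * ε) ≤ 1) :
    ((volume (Cube n a h))⁻¹ * ∫⁻ x in Cube n a h, w x ^ (1 + ε : ℝ)) ^ (1 / (1 + ε : ℝ)) ≤
      2 * ((volume (Cube n a h))⁻¹ * ∫⁻ x in Cube n a h, w x) := by
  have hr : (0 : ℝ) < 1 + ε := by positivity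
  have hr1 : (1 : ℝ) ≤ 1 + ε := by simp
  have hvi : (volume (Cube n a h))⁻¹ ≠ 0 := ENNReal.inv_ne_zero.2 volume_cube_ne_top
  by_cases ht : ∫⁻ x in Cube n a h, w x = ⊤
  · rw [ht, ENNReal.mul_top hvi, ENNReal.mul_top two_ne_zero]
    exact le_top
  by_cases h0 : ∫⁻ x in Cube n a h, w x = 0
  · have : ∫⁻ x in Cube n a h, w x ^ (1 + ε : ℝ) = 0 := by
      rw [lintegral_eq_zero_iff hw] at h0
      rw [lintegral_eq_zero_iff (hw.pow_const _)]
      filter_upwards [h0] with x hx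
      rw [hx, Pi.zero_apply, ENNReal.zero_rpow_of_pos hr]
    rw [this, mul_zero, ENNReal.zero_rpow_of_pos (by positivity)]
    exact zero_le
  have hmain := setLIntegral_rpow_le hh hw h0 ht hfin hε hεA
  rw [one_div, ENNReal.rpow_inv_le_iff hr, ENNReal.mul_rpow_of_nonneg _ _ hr.le]
  set c := (volume (Cube n a h))⁻¹ * ∫⁻ x in Cube n a h, w x with hc
  calc (volume (Cube n a h))⁻¹ * ∫⁻ x in Cube n a h, w x ^ (1 + ε : ℝ)
      ≤ (volume (Cube n a h))⁻¹ * (2 * (c ^ (ε : ℝ) * ∫⁻ x in Cube n a h, w x)) := by gcongr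
    _ = 2 * (c ^ (ε : ℝ) * c) := by rw [hc]; ring
    _ = 2 ^ (1 : ℝ) * c ^ (1 + ε : ℝ) := by
        rw [add_comm (1 : ℝ), ENNReal.rpow_add_of_nonneg _ _ ε.coe_nonneg zero_le_one,
          ENNReal.rpow_one, ENNReal.rpow_one]
    _ ≤ 2 ^ (1 + ε : ℝ) * c ^ (1 + ε : ℝ) := by
        gcongr
        exact one_le_two

end ReverseHolder

/-- sharp reverse Hölder inequality for `A_∞` weights, with
`r(w) = 1 + 1/(c_n [w]_{A_∞})`, `c_n = 2^{11+n}`, and `r(w)' ≈ [w]_{A_∞}`. -/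
theorem statement_15 (n : ℕ) (hn : 0 < n) (w : En n → ℝ≥0∞) (hw : Measurable w)
    (h0 : AInfty n w ≠ 0) (hfin : AInfty n w ≠ ⊤) :
    (∀ (a : Fin n → ℝ) (h : ℝ), 0 < h →
      ((volume (Cube n a h))⁻¹ *
          ∫⁻ x in Cube n a h, w x ^ (rExp n (AInfty n w).toReal)) ^
            (1 / rExp n (AInfty n w).toReal) ≤
        2 * ((volume (Cube n a h))⁻¹ * ∫⁻ x in Cube n a h, w x)) ∧
    ((AInfty n w).toReal ≤
        rExp n (AInfty n w).toReal / (rExp n (AInfty n w).toReal - 1) ∧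
      rExp n (AInfty n w).toReal / (rExp n (AInfty n w).toReal - 1) ≤
        ((2:ℝ) ^ (11 + n) + 1) * max (AInfty n w).toReal 1) := by

  set A := (AInfty n w).toReal with hA
  have hApos : 0 < A := ENNReal.toReal_pos h0 hfin
  have hc : (0 : ℝ) < 2 ^ (11 + n) := by positivity
  have hr' : rExp n A / (rExp n A - 1) = 2 ^ (11 + n) * A + 1 := by
    rw [rExp]
    field_simp
    ring
  refine ⟨fun a h hh => ?_, ?_, ?_⟩
  · have hε : 0 < 1 / (2 ^ (11 + n) * A) := by positivity
    rw [rExp]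
    obtain ⟨ε, he⟩ : ∃ ε : ℝ≥0, (ε : ℝ) = 1 / (2 ^ (11 + n) * A) :=
      ⟨Real.toNNReal _, Real.coe_toNNReal _ hε.le⟩
    rw [← he] at hε ⊢
    refine setLAverage_rpow_le hh hw hfin (NNReal.coe_pos.1 hε) ?_
    rw [← ENNReal.ofReal_toReal hfin, ← hA, ← ENNReal.ofReal_coe_nnreal, he,
      ← ENNReal.ofReal_ofNat 2, ← ENNReal.ofReal_pow (by norm_num),
      ← ENNReal.ofReal_mul (by positivity), ← ENNReal.ofReal_mul (by positivity),
      ← ENNReal.ofReal_mul (by norm_num), ENNReal.ofReal_le_one]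
    have : 2 * (A * 2 ^ n * (1 / (2 ^ (11 + n) * A))) = 1 / (2 : ℝ) ^ 10 := by
      rw [pow_add]
      field_simp
    rw [this]
    norm_num
  · rw [hr']
    have : (1 : ℝ) ≤ 2 ^ (11 + n) := one_le_pow₀ (by norm_num)
    nlinarith
  · rw [hr']
    have h1 := le_max_left A 1
    have h2 := le_max_right A 1
    nlinarith
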